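/- arXiv:2312.07434 — 3 statements merged into one kernel-verified Lean document; each statement's English description precedes it below -/
import Mathlib

section
/- Let R_0, R_1, ..., R_n be exchangeable real-valued random variables on a probability space, let δ ∈ (0,1), and set p = ⌈(n+1)(1−δ)⌉. Assume p ≤ n. Let C be the p-th smallest value among R_1, ..., R_n (the p-th order statistic of the calibration scores, a random variable). Then Prob(R_0 ≤ C) ≥ 1 − δ. -/
open MeasureTheory

lemma cpc_sorted_count (S : List ℝ) (hS : S.Pairwise (· ≤ ·)) (p : ℕ) (hp : 1 ≤ p)
    (hpS : p ≤ S.length) (r : ℝ) (h : S.getD (p - 1) 0 < r) :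
    p ≤ S.countP (fun x => decide (x < r)) := by
  have h1 : (S.take p).countP (fun x => decide (x < r)) = (S.take p).length := by
    rw [List.countP_eq_length]
    intro a ha
    obtain ⟨k, hk, rfl⟩ := List.mem_iff_getElem.1 ha
    rw [List.length_take] at hk
    have hk1 : k < p := by omega
    rw [List.getD_eq_getElem _ _ (by omega)] at h
    have : S[k] ≤ S[p-1] := by
      rcases Nat.lt_or_ge k (p-1) with h2 | h2
      · exact List.pairwise_iff_getElem.1 hS _ _ _ _ h2
      · have : k = p - 1 := by omega
        subst this; exact le_rfl
    simp only [List.getElem_take, decide_eq_true_eq]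
    linarith
  have h2 := (List.take_sublist p S).countP_le (p := fun x => decide (x < r))
  rw [h1, List.length_take] at h2
  omega

lemma cpc_countP_ofFn (n : ℕ) (f : Fin n → ℝ) (r : ℝ) :
    (List.ofFn f).countP (fun x => decide (x < r))
      = (Finset.univ.filter (fun i => f i < r)).card := by
  induction n with
  | zero => simp
  | succ n ih =>
    rw [List.ofFn_succ, List.countP_cons, ih, Fin.card_filter_univ_succ]
    simp only [decide_eq_true_eq, Function.comp_def]
    split_ifs <;> omega

lemma cpc_many (n p : ℕ) (hpn : p ≤ n) (x : Fin (n + 1) → ℝ) :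
    p ≤ (Finset.univ.filter
      (fun i => (Finset.univ.filter (fun j => x j < x i)).card < p)).card := by
  set σ := Tuple.sort x
  have hm : Monotone (x ∘ σ) := Tuple.monotone_sort x
  have hsub : (Finset.univ.filter (fun k : Fin (n+1) => (k : ℕ) < p)).map σ.toEmbedding ⊆
      Finset.univ.filter
      (fun i => (Finset.univ.filter (fun j => x j < x i)).card < p) := by
    intro i hi
    simp only [Finset.mem_map, Finset.mem_filter, Finset.mem_univ, true_and] at hi ⊢
    obtain ⟨k, hk, rfl⟩ := hi
    have : Finset.univ.filter (fun j => x j < x (σ.toEmbedding k)) ⊆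
        (Finset.Iio k).map σ.toEmbedding := by
      intro j hj
      simp only [Finset.mem_map, Finset.mem_filter, Finset.mem_univ, true_and,
        Finset.mem_Iio] at hj ⊢
      refine ⟨σ.symm j, ?_, by simp⟩
      by_contra hc
      have := hm (not_lt.1 hc)
      simp at this hj
      linarith
    have := Finset.card_le_card this
    rw [Finset.card_map, Fin.card_Iio] at this
    omega
  have := Finset.card_le_card hsub
  rw [Finset.card_map, Fin.card_filter_val_lt] at this
  omega

theorem conformal_prediction_coverage
    {Ω : Type*} [MeasurableSpace Ω] (μ : Measure Ω) [IsProbabilityMeasure μ]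
    (n : ℕ) (R : Fin (n + 1) → Ω → ℝ) (hmeas : ∀ i, Measurable (R i))
    (hexch : ∀ σ : Equiv.Perm (Fin (n + 1)),
      Measure.map (fun ω => fun i => R (σ i) ω) μ = Measure.map (fun ω => fun i => R i ω) μ)
    (δ : ℝ) (hδ0 : 0 < δ) (hδ1 : δ < 1)
    (p : ℕ) (hp : p = ⌈((n : ℝ) + 1) * (1 - δ)⌉₊) (hpn : p ≤ n)
    (C : Ω → ℝ)
    (hC : ∀ ω, C ω =
      ((List.ofFn fun i : Fin n => R i.succ ω).mergeSort (· ≤ ·)).getD (p - 1) 0) :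
    ENNReal.ofReal (1 - δ) ≤ μ {ω | R 0 ω ≤ C ω} := by
  have hp1 : 1 ≤ p := by
    rw [hp]
    apply Nat.one_le_ceil_iff.2
    have : 0 < 1 - δ := by linarith
    positivity
  let A : Fin (n+1) → Set (Fin (n+1) → ℝ) := fun i =>
    {x | (Finset.univ.filter (fun j => x j < x i)).card < p}
  have hA : ∀ i, MeasurableSet (A i) := by
    intro i
    have hf : Measurable (fun x : Fin (n+1) → ℝ =>
        ∑ j, (if x j < x i then 1 else 0 : ℕ)) := by
      refine Finset.measurable_sum _ fun j _ => ?_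
      exact Measurable.ite (measurableSet_lt (measurable_pi_apply j) (measurable_pi_apply i))
        measurable_const measurable_const
    have : A i = (fun x : Fin (n+1) → ℝ =>
        ∑ j, (if x j < x i then 1 else 0 : ℕ)) ⁻¹' Set.Iio p := by
      ext x
      simp [A]
    rw [this]
    exact hf measurableSet_Iio
  let V : Ω → Fin (n+1) → ℝ := fun ω i => R i ω
  have hV : Measurable V := measurable_pi_lambda _ hmeas
  have hB : ∀ i, MeasurableSet (V ⁻¹' A i) := fun i => hV (hA i)
  have heq : ∀ i, μ (V ⁻¹' A i) = μ (V ⁻¹' A 0) := by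
    intro i
    have h := hexch (Equiv.swap 0 i)
    have h2 := congrArg (fun m => m (A 0)) h
    rw [Measure.map_apply (measurable_pi_lambda _ fun j => hmeas _) (hA 0),
      Measure.map_apply hV (hA 0)] at h2
    rw [← h2]
    congr 1
    ext ω
    simp only [A, V, Set.mem_preimage, Set.mem_setOf_eq, Equiv.swap_apply_left]
    have : (Finset.univ.filter (fun j => R j ω < R i ω)).card =
        (Finset.univ.filter (fun j => R (Equiv.swap 0 i j) ω < R i ω)).card := by
      rw [Finset.card_filter, Finset.card_filter]
      exact (Equiv.sum_comp (Equiv.swap 0 i) (fun j => if R j ω < R i ω then 1 else 0)).symm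
    rw [this]
  have hsum : (p : ENNReal) ≤ ∑ i, μ (V ⁻¹' A i) := by
    calc (p : ENNReal) = ∫⁻ _, (p : ENNReal) ∂μ := by simp
      _ ≤ ∫⁻ ω, ∑ i, (V ⁻¹' A i).indicator 1 ω ∂μ := by
        apply lintegral_mono
        intro ω
        have := cpc_many n p hpn (V ω)
        have h2 : ∑ i, (V ⁻¹' A i).indicator (1 : Ω → ENNReal) ω =
          ((Finset.univ.filter (fun i =>
            (Finset.univ.filter (fun j => V ω j < V ω i)).card < p)).card : ENNReal) := by
          rw [Finset.card_filter]
          push_cast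
          refine Finset.sum_congr rfl fun i _ => ?_
          simp [Set.indicator_apply, A]
        simp only [h2]
        exact_mod_cast this
      _ = ∑ i, μ (V ⁻¹' A i) := by
        rw [lintegral_finsetSum _ fun i _ => measurable_one.indicator (hB i)]
        exact Finset.sum_congr rfl fun i _ => lintegral_indicator_one (hB i)
  have hsub : V ⁻¹' A 0 ⊆ {ω | R 0 ω ≤ C ω} := by
    intro ω hω
    simp only [A, V, Set.mem_preimage, Set.mem_setOf_eq] at hω ⊢
    by_contra hc
    rw [not_le, hC] at hc
    have h1 := cpc_sorted_count _ (by
      have := List.pairwise_mergeSort' (· ≤ ·) (List.ofFn fun i : Fin n => R i.succ ω)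
      exact this) p hp1 (by simpa using hpn) _ hc
    rw [(List.mergeSort_perm _ _).countP_eq, cpc_countP_ofFn] at h1
    rw [Fin.card_filter_univ_succ] at hω
    simp only [lt_irrefl, if_false, Function.comp_def] at hω
    omega
  refine le_trans ?_ (measure_mono hsub)
  simp only [heq, Finset.sum_const, Finset.card_univ, Fintype.card_fin, nsmul_eq_mul] at hsum
  have hfin : μ (V ⁻¹' A 0) ≠ ⊤ := measure_ne_top _ _
  rw [ENNReal.ofReal_le_iff_le_toReal hfin]
  have h3 := ENNReal.toReal_mono (by finiteness) hsum
  rw [ENNReal.toReal_mul, ENNReal.toReal_natCast, ENNReal.toReal_natCast] at h3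
  have h4 : ((n : ℝ) + 1) * (1 - δ) ≤ p := by rw [hp]; exact Nat.le_ceil _
  push_cast at h3
  exact le_of_mul_le_mul_left (h4.trans h3) (by positivity)
end

section
/- Let (X_0,Y_0), (X_1,Y_1), ..., (X_n,Y_n) be exchangeable random pairs with X_i valued in ℝ^l and Y_i valued in ℝ^p, let h : ℝ^l → ℝ^p be a measurable predictor, and let R_{S_c} : ℝ^p → ℝ be a fixed measurable non-conformity score function. Define R_i := R_{S_c}(Y_i − h(X_i)) for i = 0, 1, ..., n. Let δ ∈ (0,1), set q = ⌈(n+1)(1−δ)⌉, assume q ≤ n, and let C be the q-th smallest value among R_1, ..., R_n. Then Prob(R_0 ≤ C) ≥ 1 − δ. -/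
open MeasureTheory

lemma aux_list (L : List ℝ) (q : ℕ) (hq : 0 < q) (hqL : q ≤ L.length) (x : ℝ)
    (hx : (L.mergeSort (· ≤ ·)).getD (q - 1) 0 < x) :
    q ≤ L.countP (fun y => decide (y < x)) := by
  have hp : (L.mergeSort (· ≤ ·)).Perm L := List.mergeSort_perm L _
  have hs : (L.mergeSort (· ≤ ·)).Pairwise (· ≤ ·) := by
    have := List.pairwise_mergeSort (le := fun a b : ℝ => decide (a ≤ b))
      (by intro a b c; simpa using le_trans) (by intro a b; simpa using le_total a b) L
    simpa using this
  rw [← hp.countP_eq]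
  have hlen := hp.length_eq
  generalize L.mergeSort (· ≤ ·) = S at *
  have h1 : (S.take q).countP (fun y => decide (y < x)) = (S.take q).length := by
    rw [List.countP_eq_length]
    intro a ha
    obtain ⟨i, hi, rfl⟩ := List.mem_iff_getElem.1 ha
    have hi' : i < q := by simp at hi; omega
    rw [List.getElem_take]
    have hq1 : q - 1 < S.length := by omega
    rw [List.getD_eq_getElem _ _ hq1] at hx
    have : S[i]'(by omega) ≤ S[q-1] := by
      rcases Nat.lt_or_ge i (q-1) with h | h
      · exact List.pairwise_iff_getElem.1 hs _ _ _ _ h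
      · have : i = q - 1 := by omega
        subst this; exact le_rfl
    simpa using lt_of_le_of_lt this hx
  have h2 := (List.take_sublist q S).countP_le (p := fun y => decide (y < x))
  rw [h1, List.length_take] at h2
  omega

lemma aux_ofFn (n : ℕ) (f : Fin n → ℝ) (x : ℝ) :
    (List.ofFn f).countP (fun y => decide (y < x)) = (Finset.univ.filter fun i => f i < x).card := by
  induction n with
  | zero => simp
  | succ n ih =>
    rw [List.ofFn_succ, List.countP_cons, ih, Fin.card_filter_univ_succ]
    simp [Function.comp_def]
    split_ifs <;> omega

lemma aux_count (m q : ℕ) (hq : q ≤ m) (r : Fin m → ℝ) :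
    q ≤ (Finset.univ.filter fun j => (Finset.univ.filter fun i => r i < r j).card < q).card := by
  classical
  rcases (Finset.univ.filter fun j =>
    ¬ (Finset.univ.filter fun i => r i < r j).card < q).eq_empty_or_nonempty with h | h
  · rw [Finset.filter_eq_empty_iff] at h
    rw [Finset.filter_true_of_mem (fun j hj => not_not.1 (h hj))]
    simpa using hq
  · obtain ⟨j, hj, hmin⟩ := Finset.exists_min_image _ r h
    have hj' := (Finset.mem_filter.1 hj).2
    refine (not_lt.1 hj').trans (Finset.card_le_card ?_)
    intro i hi
    have hi' := (Finset.mem_filter.1 hi).2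
    refine Finset.mem_filter.2 ⟨Finset.mem_univ _, ?_⟩
    by_contra hc
    exact absurd (hmin i (Finset.mem_filter.2 ⟨Finset.mem_univ _, hc⟩)) (not_le.2 hi')

lemma aux_perm (m q : ℕ) (r : Fin m → ℝ) (σ : Equiv.Perm (Fin m)) (x : ℝ) :
    (Finset.univ.filter fun i => r (σ i) < x).card = (Finset.univ.filter fun i => r i < x).card := by
  simp only [Finset.card_filter]
  exact Equiv.sum_comp σ (fun i => if r i < x then 1 else 0)

/-- Conformal prediction with a fixed non-conformity score: if the pairs
`(X i, Y i)` for `i = 0, ..., n` are exchangeable, `h` is a measurable predictor,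
`Rsc` is a fixed measurable non-conformity score function,
`R i := Rsc (Y i - h (X i))`, `δ ∈ (0,1)`, `q = ⌈(n+1)(1-δ)⌉ ≤ n`, and `C` is the
`q`-th smallest value among `R 1, ..., R n`, then `Prob(R 0 ≤ C) ≥ 1 - δ`. -/
theorem conformal_prediction_score_coverage
    {Ω : Type*} [MeasurableSpace Ω] (μ : Measure Ω) [IsProbabilityMeasure μ]
    (n l p : ℕ)
    (X : Fin (n + 1) → Ω → (Fin l → ℝ)) (Y : Fin (n + 1) → Ω → (Fin p → ℝ))
    (hXmeas : ∀ i, Measurable (X i)) (hYmeas : ∀ i, Measurable (Y i))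
    (hexch : ∀ σ : Equiv.Perm (Fin (n + 1)),
      Measure.map (fun ω => fun i => (X (σ i) ω, Y (σ i) ω)) μ
        = Measure.map (fun ω => fun i => (X i ω, Y i ω)) μ)
    (h : (Fin l → ℝ) → (Fin p → ℝ)) (hh : Measurable h)
    (Rsc : (Fin p → ℝ) → ℝ) (hRsc : Measurable Rsc)
    (R : Fin (n + 1) → Ω → ℝ) (hR : ∀ i ω, R i ω = Rsc (Y i ω - h (X i ω)))
    (δ : ℝ) (hδ0 : 0 < δ) (hδ1 : δ < 1)
    (q : ℕ) (hq : q = ⌈((n : ℝ) + 1) * (1 - δ)⌉₊) (hqn : q ≤ n)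
    (C : Ω → ℝ)
    (hC : ∀ ω, C ω =
      ((List.ofFn fun i : Fin n => R i.succ ω).mergeSort (· ≤ ·)).getD (q - 1) 0) :
    ENNReal.ofReal (1 - δ) ≤ μ {ω | R 0 ω ≤ C ω} := by
  classical
  have hqpos : 0 < q := by
    rw [hq, Nat.ceil_pos]
    have : (0:ℝ) < 1 - δ := by linarith
    positivity
  -- the score of a pair
  let s : (Fin l → ℝ) × (Fin p → ℝ) → ℝ := fun z => Rsc (z.2 - h z.1)
  have hs : Measurable s := hRsc.comp (measurable_snd.sub (hh.comp measurable_fst))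
  let E : Fin (n + 1) → Set (Fin (n + 1) → (Fin l → ℝ) × (Fin p → ℝ)) := fun j =>
    {z | (Finset.univ.filter fun i => s (z i) < s (z j)).card < q}
  have hE : ∀ j, MeasurableSet (E j) := by
    intro j
    have hf : Measurable fun z : Fin (n + 1) → (Fin l → ℝ) × (Fin p → ℝ) =>
        (Finset.univ.filter fun i => s (z i) < s (z j)).card := by
      simp only [Finset.card_filter]
      refine Finset.measurable_sum _ fun i _ => ?_
      exact Measurable.ite (measurableSet_lt (hs.comp (measurable_pi_apply i))
        (hs.comp (measurable_pi_apply j))) measurable_const measurable_const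
    exact hf (measurableSet_Iio (a := q))
  let Z : Ω → Fin (n + 1) → (Fin l → ℝ) × (Fin p → ℝ) := fun ω i => (X i ω, Y i ω)
  have hZ : Measurable Z := measurable_pi_lambda _ fun i => (hXmeas i).prodMk (hYmeas i)
  have hEq : ∀ j, μ (Z ⁻¹' E j) = μ (Z ⁻¹' E 0) := by
    intro j
    have hσ := hexch (Equiv.swap 0 j)
    have hZσ : Measurable (fun ω => fun i => (X (Equiv.swap 0 j i) ω, Y (Equiv.swap 0 j i) ω)) :=
      measurable_pi_lambda _ fun i => (hXmeas _).prodMk (hYmeas _)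
    have h1 := congrArg (fun ν => ν (E 0)) hσ
    beta_reduce at h1
    rw [Measure.map_apply hZσ (hE 0), Measure.map_apply hZ (hE 0)] at h1
    rw [← h1]
    congr 1
    ext ω
    have := aux_perm (n + 1) q (fun i => s (Z ω i)) (Equiv.swap 0 j) (s (Z ω j))
    simp only [Set.mem_preimage, E, Set.mem_setOf_eq, Equiv.swap_apply_left]
    exact iff_of_eq (congrArg (· < q) this.symm)
  have hsub : Z ⁻¹' E 0 ⊆ {ω | R 0 ω ≤ C ω} := by
    intro ω hω
    by_contra hc
    simp only [Set.mem_setOf_eq, not_le] at hc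
    rw [hC] at hc
    have h1 := aux_list _ q hqpos (by simpa using hqn) _ hc
    rw [aux_ofFn] at h1
    simp only [Set.mem_preimage, E, Set.mem_setOf_eq] at hω
    rw [Fin.card_filter_univ_succ] at hω
    have h2 : ∀ i, s (Z ω i) = R i ω := fun i => (hR i ω).symm
    simp only [h2, lt_irrefl, if_false] at hω
    omega
  have hsum : (q : ENNReal) ≤ ∑ j, μ (Z ⁻¹' E j) := by
    calc (q : ENNReal) = ∫⁻ _, (q : ENNReal) ∂μ := by simp
      _ ≤ ∫⁻ ω, ∑ j, (Z ⁻¹' E j).indicator 1 ω ∂μ := by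
        refine lintegral_mono fun ω => ?_
        have := aux_count (n + 1) q (by omega) (fun i => s (Z ω i))
        have h3 : ∑ j, (Z ⁻¹' E j).indicator (1 : Ω → ENNReal) ω =
            ((Finset.univ.filter fun j =>
              (Finset.univ.filter fun i => s (Z ω i) < s (Z ω j)).card < q).card : ENNReal) := by
          rw [Finset.card_filter]
          push_cast
          refine Finset.sum_congr rfl fun j _ => ?_
          simp [Set.indicator_apply, E]
        rw [h3]
        exact Nat.cast_le.2 this
      _ = ∑ j, μ (Z ⁻¹' E j) := by
        rw [lintegral_finsetSum _ fun j _ => measurable_one.indicator (hZ (hE j))]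
        exact Finset.sum_congr rfl fun j _ => lintegral_indicator_one (hZ (hE j))
  refine le_trans ?_ (measure_mono hsub)
  simp only [hEq, Finset.sum_const, Finset.card_univ, Fintype.card_fin, nsmul_eq_mul] at hsum
  have hfin : μ (Z ⁻¹' E 0) ≠ ⊤ := measure_ne_top _ _
  rw [ENNReal.ofReal_le_iff_le_toReal hfin]
  have h4 := ENNReal.toReal_mono (ENNReal.mul_ne_top (ENNReal.natCast_ne_top _) hfin) hsum
  rw [ENNReal.toReal_mul] at h4
  simp only [ENNReal.toReal_natCast] at h4
  push_cast at h4
  have h5 : ((n : ℝ) + 1) * (1 - δ) ≤ q := hq ▸ Nat.le_ceil _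
  exact le_of_mul_le_mul_left (h5.trans h4) (by positivity)
end

section
/- Let (Z^0, Z^1, ..., Z^n) be exchangeable random variables, where each Z^i = (Z^i_1, ..., Z^i_T) takes values in (ℝ^p)^T (residual trajectories over T future time steps). Let g_1, ..., g_T : ℝ^p → ℝ be measurable per-time-step score functions and β_1, ..., β_T > 0 positive constants, and define R_i := max_{τ ∈ {1,...,T}} β_τ g_τ(Z^i_τ). Let δ ∈ (0,1), set q = ⌈(n+1)(1−δ)⌉, assume q ≤ n, and let C be the q-th smallest value among R_1, ..., R_n. Then Prob(for all τ ∈ {1,...,T}, g_τ(Z^0_τ) ≤ C/β_τ) ≥ 1 − δ. -/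
open MeasureTheory

/-- number of scores strictly below the `i`-th one -/
noncomputable def rankBelow {m : ℕ} (r : Fin m → ℝ) (i : Fin m) : ℕ := ∑ j, if r j < r i then 1 else 0

lemma rankBelow_perm {m : ℕ} (r : Fin m → ℝ) (σ : Equiv.Perm (Fin m)) (i : Fin m) :
    rankBelow (fun j => r (σ j)) i = rankBelow r (σ i) := by
  unfold rankBelow
  exact Equiv.sum_comp σ (fun j => if r j < r (σ i) then 1 else 0)

lemma rankBelow_sort {m : ℕ} (r : Fin m → ℝ) (k : Fin m) :
    rankBelow r (Tuple.sort r k) ≤ k := by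
  rw [← rankBelow_perm r (Tuple.sort r) k]
  unfold rankBelow
  have hm : Monotone (r ∘ Tuple.sort r) := Tuple.monotone_sort r
  rw [← Finset.card_filter]
  calc _ ≤ (Finset.Iio k).card := by
        apply Finset.card_le_card
        intro j hj
        simp only [Finset.mem_filter, Finset.mem_univ, true_and] at hj
        rw [Finset.mem_Iio]
        by_contra h
        exact absurd (hm (not_lt.mp h)) (not_le.mpr hj)
    _ = k := Fin.card_Iio k

lemma card_rankBelow {m : ℕ} (r : Fin m → ℝ) (q : ℕ) (hq : q ≤ m) :
    q ≤ ∑ i, if rankBelow r i < q then 1 else 0 := by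
  rw [← Equiv.sum_comp (Tuple.sort r), ← Finset.card_filter]
  calc q = ((Finset.univ : Finset (Fin q)).map (Fin.castLEEmb hq)).card := by simp
    _ ≤ _ := by
      apply Finset.card_le_card
      intro j hj
      simp only [Finset.mem_map, Finset.mem_univ, true_and] at hj
      obtain ⟨a, rfl⟩ := hj
      simp only [Finset.mem_filter, Finset.mem_univ, true_and]
      refine lt_of_le_of_lt (rankBelow_sort r _) ?_
      simp

lemma le_quantile {n : ℕ} (r : Fin (n + 1) → ℝ) (q : ℕ) (hq1 : 1 ≤ q) (hq : q ≤ n)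
    (h : rankBelow r 0 < q) :
    r 0 ≤ ((List.ofFn fun i : Fin n => r i.succ).mergeSort (· ≤ ·)).getD (q - 1) 0 := by
  set L := (List.ofFn fun i : Fin n => r i.succ).mergeSort (· ≤ ·) with hL
  have hp : L.Perm (List.ofFn fun i : Fin n => r i.succ) := List.mergeSort_perm _ _
  have hs : L.Pairwise (· ≤ ·) := List.pairwise_mergeSort' _ _
  have hlen : L.length = n := by rw [hp.length_eq]; simp
  by_contra hlt
  push Not at hlt
  rw [List.getD_eq_getElem _ _ (by omega)] at hlt
  have h1 : q ≤ L.countP (fun x => decide (x < r 0)) := by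
    have h2 : (L.take q).countP (fun x => decide (x < r 0)) = (L.take q).length := by
      rw [List.countP_eq_length]
      intro x hx
      obtain ⟨k, hk, rfl⟩ := List.getElem_of_mem hx
      have hk' : k < q := by simp at hk; omega
      rw [List.getElem_take, decide_eq_true_eq]
      refine lt_of_le_of_lt ?_ hlt
      rcases Nat.lt_or_ge k (q - 1) with h3 | h3
      · exact List.pairwise_iff_getElem.mp hs _ _ _ _ h3
      · have : k = q - 1 := by omega
        subst this; exact le_rfl
    have h3 := (List.take_sublist q L).countP_le (p := fun x => decide (x < r 0))
    rw [h2, List.length_take, hlen, min_eq_left hq] at h3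
    exact h3
  rw [hp.countP_eq] at h1
  have h4 : (List.ofFn fun i : Fin n => r i.succ).countP (fun x => decide (x < r 0))
      = rankBelow r 0 := by
    unfold rankBelow
    rw [Fin.sum_univ_succ, if_neg (lt_irrefl _), zero_add, ← Finset.card_filter,
      List.ofFn_eq_map, List.countP_map, List.countP_eq_length_filter]
    rfl
  omega

/-- Time-series conformal prediction: with exchangeable residual trajectories
`Z 0, ..., Z n` valued in `(ℝ^p)^T`, measurable per-time-step scores `g τ`,
positive constants `β τ`, joint scores `R i ω = max_τ β τ * g τ (Z i ω τ)`,
`δ ∈ (0,1)`, `q = ⌈(n+1)(1-δ)⌉ ≤ n`, and `C` the `q`-th smallest of `R 1, ..., R n`,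
we have `Prob(∀ τ, g τ (Z 0 τ) ≤ C / β τ) ≥ 1 - δ`. -/
theorem timeseries_conformal_coverage
    {Ω : Type*} [MeasurableSpace Ω] (μ : Measure Ω) [IsProbabilityMeasure μ]
    (n T p : ℕ) (hT : 1 ≤ T)
    (Z : Fin (n + 1) → Ω → (Fin T → (Fin p → ℝ)))
    (hZmeas : ∀ i, Measurable (Z i))
    (hexch : ∀ σ : Equiv.Perm (Fin (n + 1)),
      Measure.map (fun ω => fun i => Z (σ i) ω) μ = Measure.map (fun ω => fun i => Z i ω) μ)
    (g : Fin T → (Fin p → ℝ) → ℝ) (hg : ∀ τ, Measurable (g τ))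
    (β : Fin T → ℝ) (hβ : ∀ τ, 0 < β τ)
    (R : Fin (n + 1) → Ω → ℝ)
    (hR : ∀ i ω, R i ω =
      Finset.univ.sup' ⟨⟨0, hT⟩, Finset.mem_univ _⟩ fun τ => β τ * g τ (Z i ω τ))
    (δ : ℝ) (hδ0 : 0 < δ) (hδ1 : δ < 1)
    (q : ℕ) (hq : q = ⌈((n : ℝ) + 1) * (1 - δ)⌉₊) (hqn : q ≤ n)
    (C : Ω → ℝ)
    (hC : ∀ ω, C ω =
      ((List.ofFn fun i : Fin n => R i.succ ω).mergeSort (· ≤ ·)).getD (q - 1) 0) :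
    ENNReal.ofReal (1 - δ)
      ≤ μ {ω | ∀ τ : Fin T, g τ (Z 0 ω τ) ≤ C ω / β τ} := by
  set F : (Fin T → (Fin p → ℝ)) → ℝ := fun z =>
    Finset.univ.sup' ⟨⟨0, hT⟩, Finset.mem_univ _⟩ fun τ => β τ * g τ (z τ) with hF
  have hFm : Measurable F := by
    have : F = Finset.univ.sup' ⟨⟨0, hT⟩, Finset.mem_univ _⟩
        (fun τ => fun z : Fin T → (Fin p → ℝ) => β τ * g τ (z τ)) := by
      funext z
      exact (Finset.sup'_apply (C := fun _ => ℝ) ⟨⟨0, hT⟩, Finset.mem_univ _⟩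
        (fun τ => fun z : Fin T → (Fin p → ℝ) => β τ * g τ (z τ)) z).symm
    rw [this]
    refine Finset.measurable_sup' _ fun τ _ => ?_
    exact ((hg τ).comp (measurable_pi_apply τ)).const_mul _
  have hRF : ∀ i ω, R i ω = F (Z i ω) := hR
  have hq1 : 1 ≤ q := by
    rw [hq]
    apply Nat.ceil_pos.mpr
    have : 0 < 1 - δ := by linarith
    positivity
  set B : Fin (n + 1) → Set (Fin (n + 1) → (Fin T → (Fin p → ℝ))) := fun i =>
    {z | rankBelow (fun j => F (z j)) i < q} with hB
  have hBm : ∀ i, MeasurableSet (B i) := by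
    intro i
    have hm : Measurable (fun z : Fin (n + 1) → (Fin T → (Fin p → ℝ)) =>
        rankBelow (fun j => F (z j)) i) := by
      unfold rankBelow
      refine Finset.measurable_sum _ fun j _ => ?_
      refine Measurable.ite ?_ measurable_const measurable_const
      exact measurableSet_lt (hFm.comp (measurable_pi_apply j)) (hFm.comp (measurable_pi_apply i))
    exact hm (measurableSet_Iio (a := q))
  have hZm : ∀ σ : Equiv.Perm (Fin (n + 1)), Measurable (fun ω => fun i => Z (σ i) ω) :=
    fun σ => measurable_pi_lambda _ fun i => hZmeas _
  have hZm1 : Measurable (fun ω => fun i => Z i ω) := measurable_pi_lambda _ fun i => hZmeas _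
  set A : Fin (n + 1) → Set Ω := fun i => {ω | rankBelow (fun j => R j ω) i < q} with hA
  have hAB : ∀ i, A i = (fun ω => fun i => Z i ω) ⁻¹' (B i) := by
    intro i
    ext ω
    simp [hA, hB, hRF]
  have hAm : ∀ i, MeasurableSet (A i) := fun i => by
    rw [hAB]; exact hZm1 (hBm i)
  have hAeq : ∀ i, μ (A i) = μ (A 0) := by
    intro i
    have h1 := congrArg (fun ν => ν (B 0)) (hexch (Equiv.swap 0 i))
    beta_reduce at h1
    rw [Measure.map_apply (hZm _) (hBm 0), Measure.map_apply hZm1 (hBm 0), ← hAB] at h1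
    rw [← h1]
    congr 1
    ext ω
    simp only [hA, hB, Set.mem_setOf_eq, Set.mem_preimage, hRF]
    rw [rankBelow_perm (fun j => F (Z j ω)) (Equiv.swap 0 i) 0, Equiv.swap_apply_left]
  have hsum : (q : ENNReal) ≤ ((n + 1 : ℕ) : ENNReal) * μ (A 0) := by
    calc (q : ENNReal) = ∫⁻ _, (q : ENNReal) ∂μ := by simp
      _ ≤ ∫⁻ ω, ∑ i, (A i).indicator 1 ω ∂μ := by
        apply lintegral_mono
        intro ω
        have h := card_rankBelow (fun j => R j ω) q (by omega)
        have h' : (q : ENNReal) ≤ ((∑ i, if rankBelow (fun j => R j ω) i < q then 1 else 0 : ℕ) :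
            ENNReal) := by exact_mod_cast h
        refine h'.trans (le_of_eq ?_)
        push_cast
        refine Finset.sum_congr rfl fun i _ => ?_
        simp [Set.indicator_apply, hA]
      _ = ∑ i, μ (A i) := by
        rw [lintegral_finsetSum _ fun i _ => measurable_one.indicator (hAm i)]
        exact Finset.sum_congr rfl fun i _ => lintegral_indicator_one (hAm i)
      _ = _ := by simp [hAeq]
  have hsub : A 0 ⊆ {ω | ∀ τ : Fin T, g τ (Z 0 ω τ) ≤ C ω / β τ} := by
    intro ω hω τ
    have h := le_quantile (fun j => R j ω) q hq1 hqn hω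
    rw [← hC ω] at h
    rw [le_div_iff₀ (hβ τ), mul_comm]
    refine le_trans ?_ h
    simp only [hR]
    exact Finset.le_sup' (fun τ => β τ * g τ (Z 0 ω τ)) (Finset.mem_univ τ)
  refine le_trans ?_ (measure_mono hsub)
  have hreal : (q : ℝ) ≤ ((n : ℝ) + 1) * (μ (A 0)).toReal := by
    have := ENNReal.toReal_mono (by finiteness) hsum
    rw [ENNReal.toReal_mul, ENNReal.toReal_natCast, ENNReal.toReal_natCast] at this
    push_cast at this
    exact this
  have hceil : ((n : ℝ) + 1) * (1 - δ) ≤ q := by rw [hq]; exact Nat.le_ceil _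
  have hfin : 1 - δ ≤ (μ (A 0)).toReal :=
    le_of_mul_le_mul_left (hceil.trans hreal) (by positivity)
  exact ENNReal.ofReal_le_of_le_toReal hfin
end
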